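/- arXiv:0904.4568 — 3 statements merged into one kernel-verified Lean document; each statement's English description precedes it below -/
import Mathlib

section
/- Let α > 0 and consider the operator B acting on smooth α-periodic functions φ = (φ₁,φ₂,φ₃,φ₄) : ℝ → ℝ⁴ by Bφ = (-½φ₁ - φ₂', φ₁' - ½φ₂, ½φ₃ - φ₄', φ₃' + ½φ₄). Then a real number λ admits a nonzero smooth α-periodic solution φ of Bφ = λφ if and only if λ ∈ {-½ + 2πn/α : n ∈ ℤ} ∪ {½ + 2πn/α : n ∈ ℤ}. -/
/-- A nonzero `α`-periodic solution of the rotation system `f' = c g`, `g' = -c f` forces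
`c ∈ (2π/α) ℤ`. -/
theorem exists_int_of_periodic_rotation {α c : ℝ} (hα : α ≠ 0) {f g : ℝ → ℝ}
    (hf : ∀ x, HasDerivAt f (c * g x) x) (hg : ∀ x, HasDerivAt g (-(c * f x)) x)
    (pf : Function.Periodic f α) (pg : Function.Periodic g α)
    {x : ℝ} (hx : f x ≠ 0 ∨ g x ≠ 0) : ∃ n : ℤ, c = 2 * Real.pi * (n : ℝ) / α := by
  have hlin (y : ℝ) : HasDerivAt (fun t => c * t) c y := by
    simpa using (hasDerivAt_id y).const_mul c
  have hA (y : ℝ) :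
      HasDerivAt (fun t => f t * Real.cos (c * t) - g t * Real.sin (c * t)) 0 y := by
    refine HasDerivAt.congr_deriv (((hf y).mul (hlin y).cos).sub ((hg y).mul (hlin y).sin)) ?_
    ring
  have hB (y : ℝ) :
      HasDerivAt (fun t => f t * Real.sin (c * t) + g t * Real.cos (c * t)) 0 y := by
    refine HasDerivAt.congr_deriv (((hf y).mul (hlin y).sin).add ((hg y).mul (hlin y).cos)) ?_
    ring
  have eA := is_const_of_deriv_eq_zero (fun y => (hA y).differentiableAt)
    (fun y => (hA y).deriv) (x + α) x
  have eB := is_const_of_deriv_eq_zero (fun y => (hB y).differentiableAt)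
    (fun y => (hB y).deriv) (x + α) x
  simp only [pf x, pg x, mul_add, Real.cos_add, Real.sin_add] at eA eB
  have hpos : f x ^ 2 + g x ^ 2 ≠ 0 := by
    rcases hx with h | h <;> positivity
  have hcos : Real.cos (c * α) = 1 := by
    refine mul_left_cancel₀ hpos ?_
    linear_combination (f x * Real.cos (c * x) - g x * Real.sin (c * x)) * eA +
      (f x * Real.sin (c * x) + g x * Real.cos (c * x)) * eB +
      (f x ^ 2 + g x ^ 2) * (1 - Real.cos (c * α)) * Real.sin_sq_add_cos_sq (c * x)
  obtain ⟨n, hn⟩ := (Real.cos_eq_one_iff _).1 hcos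
  refine ⟨n, ?_⟩
  rw [eq_div_iff hα]
  linarith

theorem hasDerivAt_sin_const_mul (c x : ℝ) :
    HasDerivAt (fun t => Real.sin (c * t)) (c * Real.cos (c * x)) x := by
  have := ((hasDerivAt_id x).const_mul c).sin
  simpa [mul_comm] using this

theorem hasDerivAt_cos_const_mul (c x : ℝ) :
    HasDerivAt (fun t => Real.cos (c * t)) (-(c * Real.sin (c * x))) x := by
  have := ((hasDerivAt_id x).const_mul c).cos
  simpa [mul_comm] using this

theorem periodic_sin_const_mul {α c : ℝ} {n : ℤ} (h : c * α = n * (2 * Real.pi)) :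
    Function.Periodic (fun t => Real.sin (c * t)) α := fun x => by
  simp only [mul_add, h, Real.sin_add_int_mul_two_pi]

theorem periodic_cos_const_mul {α c : ℝ} {n : ℤ} (h : c * α = n * (2 * Real.pi)) :
    Function.Periodic (fun t => Real.cos (c * t)) α := fun x => by
  simp only [mul_add, h, Real.cos_add_int_mul_two_pi]


/-- The spectrum of the cross-section operator `B` of the Hodge–Dirac model operator
along an edge of cone-angle `α`, acting on smooth `α`-periodic `ℝ⁴`-valued functions by
`Bφ = (-½φ₁ - φ₂', φ₁' - ½φ₂, ½φ₃ - φ₄', φ₃' + ½φ₄)`, equals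
`{-½ + 2πn/α : n ∈ ℤ} ∪ {½ + 2πn/α : n ∈ ℤ}`. -/
theorem stmt_8 (α : ℝ) (hα : 0 < α) (lam : ℝ) :
    (∃ φ₁ φ₂ φ₃ φ₄ : ℝ → ℝ,
      ContDiff ℝ (⊤ : ℕ∞) φ₁ ∧ ContDiff ℝ (⊤ : ℕ∞) φ₂ ∧ ContDiff ℝ (⊤ : ℕ∞) φ₃ ∧ ContDiff ℝ (⊤ : ℕ∞) φ₄ ∧
      Function.Periodic φ₁ α ∧ Function.Periodic φ₂ α ∧
      Function.Periodic φ₃ α ∧ Function.Periodic φ₄ α ∧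
      (∃ x : ℝ, φ₁ x ≠ 0 ∨ φ₂ x ≠ 0 ∨ φ₃ x ≠ 0 ∨ φ₄ x ≠ 0) ∧
      (∀ x : ℝ,
        -(1/2) * φ₁ x - deriv φ₂ x = lam * φ₁ x ∧
        deriv φ₁ x - (1/2) * φ₂ x = lam * φ₂ x ∧
        (1/2) * φ₃ x - deriv φ₄ x = lam * φ₃ x ∧
        deriv φ₃ x + (1/2) * φ₄ x = lam * φ₄ x)) ↔
    ((∃ n : ℤ, lam = -(1/2) + 2 * Real.pi * (n : ℝ) / α) ∨
     (∃ n : ℤ, lam = 1/2 + 2 * Real.pi * (n : ℝ) / α)) := by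
  constructor
  · rintro ⟨φ₁, φ₂, φ₃, φ₄, s₁, s₂, s₃, s₄, p₁, p₂, p₃, p₄, ⟨x, hx⟩, h⟩
    have hd {φ : ℝ → ℝ} (s : ContDiff ℝ (⊤ : ℕ∞) φ) {v y : ℝ} (e : deriv φ y = v) :
        HasDerivAt φ v y :=
      e ▸ (s.differentiable (by simp) y).hasDerivAt
    by_cases h12 : φ₁ x ≠ 0 ∨ φ₂ x ≠ 0
    · obtain ⟨n, hn⟩ := exists_int_of_periodic_rotation (c := lam + 1/2) hα.ne'
        (fun y => hd s₁ (by linarith [(h y).2.1]))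
        (fun y => hd s₂ (by linarith [(h y).1])) p₁ p₂ h12
      exact Or.inl ⟨n, by linarith⟩
    · obtain ⟨n, hn⟩ := exists_int_of_periodic_rotation (c := lam - 1/2) hα.ne'
        (fun y => hd s₃ (by linarith [(h y).2.2.2]))
        (fun y => hd s₄ (by linarith [(h y).2.2.1])) p₃ p₄ (x := x) (by tauto)
      exact Or.inr ⟨n, by linarith⟩
  · have hper (n : ℤ) : 2 * Real.pi * (n : ℝ) / α * α = n * (2 * Real.pi) := by
      field_simp
    have hz : Function.Periodic (fun _ : ℝ => (0 : ℝ)) α := fun _ => rfl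
    rintro (⟨n, rfl⟩ | ⟨n, rfl⟩)
    · refine ⟨_, _, fun _ => 0, fun _ => 0, by fun_prop, by fun_prop, contDiff_const,
        contDiff_const, periodic_sin_const_mul (hper n), periodic_cos_const_mul (hper n),
        hz, hz, ⟨0, by simp⟩, fun x => ?_⟩
      rw [(hasDerivAt_sin_const_mul _ x).deriv, (hasDerivAt_cos_const_mul _ x).deriv, deriv_const]
      refine ⟨?_, ?_, ?_, ?_⟩ <;> ring
    · refine ⟨fun _ => 0, fun _ => 0, _, _, contDiff_const, contDiff_const, by fun_prop,
        by fun_prop, hz, hz, periodic_sin_const_mul (hper n), periodic_cos_const_mul (hper n),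
        ⟨0, by simp⟩, fun x => ?_⟩
      rw [(hasDerivAt_sin_const_mul _ x).deriv, (hasDerivAt_cos_const_mul _ x).deriv, deriv_const]
      refine ⟨?_, ?_, ?_, ?_⟩ <;> ring
end

section
/- For every real 3×3 matrix A, one has ⟨2A + tr(A)·I₃ - Aᵀ, A⟩ ≥ ⟨A, A⟩, where ⟨X, Y⟩ = tr(XᵀY) is the Frobenius inner product; equivalently, 2·tr(AᵀA) + (tr A)² - tr(A²) ≥ tr(AᵀA). -/
open Matrix

/-- The trace of `A * A` is at most the squared Frobenius norm of `A`. -/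
theorem trace_mul_self_le_trace_transpose_mul_self {n : Type*} [Fintype n] (A : Matrix n n ℝ) :
    Matrix.trace (A * A) ≤ Matrix.trace (Aᵀ * A) := by
  have h : 0 ≤ Matrix.trace ((A - Aᵀ)ᵀ * (A - Aᵀ)) := by
    simp only [Matrix.trace, Matrix.diag_apply, Matrix.mul_apply, Matrix.transpose_apply]
    exact Finset.sum_nonneg fun i _ => Finset.sum_nonneg fun j _ => mul_self_nonneg _
  have h_tr : Matrix.trace (Aᵀ * Aᵀ) = Matrix.trace (A * A) := by
    rw [← Matrix.transpose_mul, Matrix.trace_transpose]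
  simp only [Matrix.transpose_sub, Matrix.transpose_transpose, Matrix.sub_mul, Matrix.mul_sub,
    Matrix.trace_sub, h_tr, Matrix.trace_mul_comm A Aᵀ] at h
  linarith

/-- Pointwise positivity of the Weitzenböck remainder `H = TTᵗ + TᵗT ≥ 1` on
`ℰ`-valued 1-forms: for every real 3×3 matrix `A`, with the Frobenius inner product
`⟨X, Y⟩ = tr(XᵀY)`, one has `⟨2A + tr(A)·I₃ - Aᵀ, A⟩ ≥ ⟨A, A⟩`; equivalently
`2·tr(AᵀA) + (tr A)² - tr(A²) ≥ tr(AᵀA)`. -/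
theorem stmt_12 (A : Matrix (Fin 3) (Fin 3) ℝ) :
    Matrix.trace (Aᵀ * A) ≤
      Matrix.trace (Aᵀ * ((2 : ℝ) • A + Matrix.trace A • (1 : Matrix (Fin 3) (Fin 3) ℝ) - Aᵀ)) ∧
    Matrix.trace (Aᵀ * A) ≤
      2 * Matrix.trace (Aᵀ * A) + (Matrix.trace A)^2 - Matrix.trace (A * A) := by
  have h := trace_mul_self_le_trace_transpose_mul_self A
  have h_tr : Matrix.trace (Aᵀ * Aᵀ) = Matrix.trace (A * A) := by
    rw [← Matrix.transpose_mul, Matrix.trace_transpose]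
  constructor
  · simp only [Matrix.mul_sub, Matrix.mul_add, Matrix.mul_smul, Matrix.mul_one, Matrix.trace_sub,
      Matrix.trace_add, Matrix.trace_smul, Matrix.trace_transpose, smul_eq_mul, h_tr]
    nlinarith [mul_self_nonneg (Matrix.trace A)]
  · nlinarith [sq_nonneg (Matrix.trace A)]
end

section
/- Let ε ∈ (0,1) and let F : (0,ε) → [0,∞] be a measurable function with ∫_0^ε F(r) dr < ∞. Then liminf_{r→0⁺} r·|log r|·F(r) = 0; in other words, there exists a sequence r_n → 0 with r_n·|log r_n|·F(r_n) → 0. -/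
open MeasureTheory Filter

lemma not_integrableOn_inv_mul_abs_log {δ : ℝ} (hδ : 0 < δ) :
    ¬ IntegrableOn (fun r : ℝ => (r * |Real.log r|)⁻¹) (Set.Ioo 0 δ) := by
  have hsub : ∀ᶠ x in nhdsWithin (0 : ℝ) (Set.Ioi 0), x ∈ Set.Ioo (0 : ℝ) 1 :=
    Ioo_mem_nhdsGT one_pos
  have hderiv : ∀ x ∈ Set.Ioo (0 : ℝ) 1,
      HasDerivAt (fun x => Real.log (Real.log x)) (x⁻¹ / Real.log x) x := fun x hx =>
    (Real.hasDerivAt_log hx.1.ne').log (Real.log_neg hx.1 hx.2).ne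
  refine not_integrableOn_of_tendsto_norm_atTop_of_deriv_isBigO_filter
    (f := fun x => Real.log (Real.log x)) (nhdsWithin (0 : ℝ) (Set.Ioi 0))
    (Ioo_mem_nhdsGT hδ) (hsub.mono fun x hx => (hderiv x hx).differentiableAt) ?_ ?_
  · refine tendsto_norm_atTop_atTop.comp ?_
    have h := Real.tendsto_log_atTop.comp
      (tendsto_abs_atBot_atTop.comp Real.tendsto_log_nhdsGT_zero)
    simpa only [Function.comp_def, Real.log_abs] using h
  · refine Asymptotics.IsBigO.of_bound 1 (hsub.mono fun x hx => ?_)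
    rw [(hderiv x hx).deriv]
    simp [div_eq_mul_inv, mul_comm]

lemma frequently_mul_abs_log_mul_lt {ε : ℝ} (hε : ε ∈ Set.Ioo (0 : ℝ) 1) {F : ℝ → ENNReal}
    (hFint : (∫⁻ r in Set.Ioo (0 : ℝ) ε, F r) < ⊤) {c : ENNReal} (hc : 0 < c) (hc' : c ≠ ⊤) :
    ∃ᶠ r in nhdsWithin 0 (Set.Ioo (0 : ℝ) ε),
      ENNReal.ofReal (r * |Real.log r|) * F r < c := by
  intro hev
  rw [nhdsWithin_Ioo_eq_nhdsGT hε.1] at hev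
  obtain ⟨δ, hδ, hδs⟩ := (mem_nhdsGT_iff_exists_Ioo_subset' hε.1).1
    (inter_mem hev (Ioo_mem_nhdsGT hε.1))
  have hmeas : Measurable fun r : ℝ => (r * |Real.log r|)⁻¹ := by
    have := Real.measurable_log
    fun_prop
  refine not_integrableOn_inv_mul_abs_log hδ ⟨hmeas.aestronglyMeasurable, ?_⟩
  have hle : ∀ r ∈ Set.Ioo (0 : ℝ) δ, ‖(r * |Real.log r|)⁻¹‖ₑ ≤ c⁻¹ * F r := by
    intro r hr
    obtain ⟨hlow, hr0, hrε⟩ := hδs hr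
    have hpos : 0 < r * |Real.log r| :=
      mul_pos hr0 (abs_pos.2 (Real.log_neg hr0 (hrε.trans hε.2)).ne)
    rw [Real.enorm_of_nonneg (inv_nonneg.2 hpos.le), ENNReal.ofReal_inv_of_pos hpos]
    have hlow' : c ≤ ENNReal.ofReal (r * |Real.log r|) * F r := not_lt.1 hlow
    have hx0 : ENNReal.ofReal (r * |Real.log r|) ≠ 0 := (ENNReal.ofReal_pos.2 hpos).ne'
    generalize ENNReal.ofReal (r * |Real.log r|) = x at *
    calc x⁻¹ = x⁻¹ * (c⁻¹ * c) := by rw [ENNReal.inv_mul_cancel hc.ne' hc', mul_one]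
      _ ≤ x⁻¹ * (c⁻¹ * (x * F r)) := by gcongr
      _ = (x⁻¹ * x) * (c⁻¹ * F r) := by ring
      _ ≤ 1 * (c⁻¹ * F r) := by gcongr; exact ENNReal.inv_mul_le_one x
      _ = c⁻¹ * F r := one_mul _
  calc ∫⁻ r in Set.Ioo (0 : ℝ) δ, ‖(r * |Real.log r|)⁻¹‖ₑ
      ≤ ∫⁻ r in Set.Ioo (0 : ℝ) δ, c⁻¹ * F r := setLIntegral_mono' measurableSet_Ioo hle
    _ ≤ ∫⁻ r in Set.Ioo (0 : ℝ) ε, c⁻¹ * F r :=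
        lintegral_mono_set fun r hr => (hδs hr).2
    _ = c⁻¹ * ∫⁻ r in Set.Ioo (0 : ℝ) ε, F r :=
        lintegral_const_mul' _ _ (ENNReal.inv_ne_top.2 hc.ne')
    _ < ⊤ := ENNReal.mul_lt_top (ENNReal.inv_lt_top.2 hc) hFint

/-- Cheeger's lemma on boundary terms: if `F : (0,ε) → [0,∞]` is measurable with
`∫_0^ε F < ∞`, then `liminf_{r→0⁺} r·|log r|·F(r) = 0`; in particular there is a
sequence `rₙ → 0` in `(0,ε)` with `rₙ·|log rₙ|·F(rₙ) → 0`. -/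
theorem stmt_15 (ε : ℝ) (hε : ε ∈ Set.Ioo (0:ℝ) 1) (F : ℝ → ENNReal)
    (hFmeas : Measurable F)
    (hFint : (∫⁻ r in Set.Ioo (0:ℝ) ε, F r) < ⊤) :
    Filter.liminf (fun r => ENNReal.ofReal (r * |Real.log r|) * F r)
        (nhdsWithin 0 (Set.Ioo (0:ℝ) ε)) = 0 ∧
      ∃ u : ℕ → ℝ, (∀ n, u n ∈ Set.Ioo (0:ℝ) ε) ∧
        Filter.Tendsto u Filter.atTop (nhds 0) ∧
        Filter.Tendsto (fun n => ENNReal.ofReal (u n * |Real.log (u n)|) * F (u n))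
          Filter.atTop (nhds 0) := by
  have hfreq := fun (c : ENNReal) (hc : 0 < c) (hc' : c ≠ ⊤) =>
    frequently_mul_abs_log_mul_lt hε hFint hc hc'
  refine ⟨le_antisymm (le_of_forall_gt_imp_ge_of_dense fun c hc => ?_) (zero_le), ?_⟩
  · rcases eq_or_ne c ⊤ with rfl | hc'
    · exact le_top
    · exact liminf_le_of_frequently_le' ((hfreq c hc hc').mono fun _ h => h.le)
  · have hex : ∀ n : ℕ, ∃ r ∈ Set.Ioo (0 : ℝ) ε, r < 1 / ((n : ℝ) + 1) ∧
        ENNReal.ofReal (r * |Real.log r|) * F r < ((n : ENNReal))⁻¹ ⊓ 1 := by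
      intro n
      have hsmall : ∀ᶠ r in nhdsWithin 0 (Set.Ioo (0 : ℝ) ε), r < 1 / ((n : ℝ) + 1) :=
        nhdsWithin_le_nhds (Iio_mem_nhds Nat.one_div_pos_of_nat)
      obtain ⟨r, h, hr, hlt⟩ := ((hfreq ((n : ENNReal)⁻¹ ⊓ 1) (by simp) (by simp)).and_eventually
        (eventually_mem_nhdsWithin.and hsmall)).exists
      exact ⟨r, hr, hlt, h⟩
    choose u hu hlt hG using hex
    refine ⟨u, hu, ?_, ?_⟩
    · exact squeeze_zero (fun n => (hu n).1.le) (fun n => (hlt n).le)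
        tendsto_one_div_add_atTop_nhds_zero_nat
    · exact tendsto_of_tendsto_of_tendsto_of_le_of_le tendsto_const_nhds
        ENNReal.tendsto_inv_nat_nhds_zero (fun _ => zero_le)
        (fun n => (hG n).le.trans inf_le_left)
end
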